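/- For every d ∈ ℕ there is a constant C_d such that for every real polynomial Q(s) = Σ_{j=1}^d h_j s^j, every index 1 ≤ j ≤ d with h_j ≠ 0, and every B > 0, one has | ∫_{B/2}^{B} e^{2πi Q(s)} ds | ≤ C_d |h_j|^{−1/d} B^{1 − j/d}. -/

import Mathlib

open MeasureTheory Real

noncomputable section

open Polynomial

/-- The Poisson kernel (up to the factor `π`) centred at `x` with height `|y|`. -/
def poissonKer (x y t : ℝ) : ℝ := |y| / ((t - x) ^ 2 + y ^ 2)

lemma poissonKer_nonneg (x y t : ℝ) : 0 ≤ poissonKer x y t := by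
  unfold poissonKer; positivity

lemma continuous_poissonKer (x y : ℝ) : Continuous (poissonKer x y) := by
  unfold poissonKer
  rcases eq_or_ne y 0 with rfl | hy
  · simpa using continuous_const
  · have : ∀ t : ℝ, (t - x) ^ 2 + y ^ 2 ≠ 0 := fun t => by positivity
    fun_prop (disch := exact this _)

lemma integral_poissonKer_le (x y a b : ℝ) : ∫ t in a..b, poissonKer x y t ≤ π := by
  rcases eq_or_ne y 0 with rfl | hy
  · simpa [poissonKer] using pi_pos.le
  · have hy' : 0 < |y| := abs_pos.mpr hy
    have hd : ∀ t ∈ Set.uIcc a b,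
        HasDerivAt (fun t => arctan ((t - x) / |y|)) (poissonKer x y t) t := by
      intro t _
      have h := (((hasDerivAt_id t).sub_const x).div_const |y|).arctan
      refine h.congr_deriv ?_
      have h2 : (t - x) ^ 2 + |y| ^ 2 ≠ 0 := by positivity
      rw [poissonKer, ← sq_abs y]
      simp only [id]
      field_simp
      ring
    rw [intervalIntegral.integral_eq_sub_of_hasDerivAt hd
      ((continuous_poissonKer x y).intervalIntegrable _ _)]
    linarith [arctan_lt_pi_div_two ((b - x) / |y|), neg_pi_div_two_lt_arctan ((a - x) / |y|)]

lemma continuous_multiset_sum_map {α : Type*} (s : Multiset α) (φ : α → ℝ → ℝ)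
    (hφ : ∀ z, Continuous (φ z)) : Continuous fun t => (s.map (φ · t)).sum := by
  induction s using Multiset.induction with
  | empty => simpa using continuous_const
  | cons z s ih =>
    simp only [Multiset.map_cons, Multiset.sum_cons]
    exact (hφ z).add ih

lemma integral_multiset_sum_map_le {α : Type*} (s : Multiset α) (φ : α → ℝ → ℝ)
    (hφ : ∀ z, Continuous (φ z)) {a b K : ℝ} (hK : ∀ z, ∫ t in a..b, φ z t ≤ K) :
    ∫ t in a..b, (s.map (φ · t)).sum ≤ s.card * K := by
  induction s using Multiset.induction with
  | empty => simp
  | cons z s ih =>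
    simp only [Multiset.map_cons, Multiset.sum_cons, Multiset.card_cons, Nat.cast_add, Nat.cast_one]
    rw [intervalIntegral.integral_add ((hφ z).intervalIntegrable _ _)
      ((continuous_multiset_sum_map s φ hφ).intervalIntegrable _ _)]
    linarith [hK z]

lemma integral_abs_derivative_div_le (P : ℝ[X]) {ε a b : ℝ} (hε : 0 < ε) (hab : a ≤ b) :
    ∫ t in a..b, |P.derivative.eval t| / (P.eval t ^ 2 + ε ^ 2) ≤ P.natDegree * π / ε := by
  set R : ℂ[X] := P.map Complex.ofRealHom + C (ε * Complex.I) with hR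
  have hRe : ∀ t : ℝ, R.eval (t : ℂ) = (P.eval t : ℝ) + ε * Complex.I := fun t => by
    have : eval ((Complex.ofRealHom t : ℂ)) (P.map Complex.ofRealHom)
        = Complex.ofRealHom (P.eval t) := eval_map_apply _ _
    simpa [hR] using this
  have hRd : ∀ t : ℝ, R.derivative.eval (t : ℂ) = (P.derivative.eval t : ℝ) := fun t => by
    have : eval ((Complex.ofRealHom t : ℂ)) (P.derivative.map Complex.ofRealHom)
        = Complex.ofRealHom (P.derivative.eval t) := eval_map_apply _ _
    simpa [hR, derivative_map] using this
  have hdeg : R.roots.card ≤ P.natDegree := by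
    refine (card_roots' R).trans ?_
    rw [hR, natDegree_add_C]
    exact natDegree_map_le
  have hpt : ∀ t : ℝ, |P.derivative.eval t| / (P.eval t ^ 2 + ε ^ 2)
      ≤ 1 / ε * (R.roots.map (fun z => poissonKer z.re z.im t)).sum := by
    intro t
    have hne : R.eval (t : ℂ) ≠ 0 := by
      rw [hRe]; intro h
      have := congrArg Complex.im h
      simp at this
      exact hε.ne' this
    have hlog := (IsAlgClosed.splits R).eval_derivative_div_eval_of_ne_zero hne
    rw [hRe, hRd] at hlog
    have him := congrArg Complex.imAddGroupHom hlog
    rw [map_multiset_sum, Multiset.map_map] at him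
    have hl : Complex.imAddGroupHom (((P.derivative.eval t : ℝ) : ℂ) / ((P.eval t : ℝ) + ε * Complex.I))
        = -(ε * (P.derivative.eval t / (P.eval t ^ 2 + ε ^ 2))) := by
      simp [Complex.div_im, Complex.normSq_apply]
      ring
    rw [hl] at him
    have habs : ε * (|P.derivative.eval t| / (P.eval t ^ 2 + ε ^ 2))
        ≤ (R.roots.map (fun z => poissonKer z.re z.im t)).sum := by
      have h1 : ε * (|P.derivative.eval t| / (P.eval t ^ 2 + ε ^ 2))
          = |-(ε * (P.derivative.eval t / (P.eval t ^ 2 + ε ^ 2)))| := by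
        rw [abs_neg, abs_mul, abs_div, abs_of_pos hε,
          abs_of_pos (show 0 < P.eval t ^ 2 + ε ^ 2 by positivity)]
      rw [h1, him]
      refine (Multiset.abs_sum_le_sum_abs).trans (le_of_eq ?_)
      rw [Multiset.map_map]
      congr 1
      refine Multiset.map_congr rfl fun z _ => ?_
      simp [poissonKer, Complex.normSq_apply, abs_div]
      rw [abs_of_nonneg (add_nonneg (mul_self_nonneg (t - z.re)) (mul_self_nonneg z.im))]
      ring_nf
    rw [div_mul_eq_mul_div, one_mul, le_div_iff₀ hε]
    linarith
  have hpos : ∀ t : ℝ, P.eval t ^ 2 + ε ^ 2 ≠ 0 := fun t => by positivity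
  calc ∫ t in a..b, |P.derivative.eval t| / (P.eval t ^ 2 + ε ^ 2)
      ≤ ∫ t in a..b, 1 / ε * (R.roots.map (fun z => poissonKer z.re z.im t)).sum := by
        refine intervalIntegral.integral_mono_on hab ?_ ?_ fun t _ => hpt t
        · refine Continuous.intervalIntegrable ?_ _ _
          fun_prop (disch := exact hpos _)
        · exact ((continuous_multiset_sum_map _ (fun z : ℂ => poissonKer z.re z.im) fun z =>
            continuous_poissonKer _ _).const_mul _).intervalIntegrable _ _
    _ ≤ 1 / ε * (R.roots.card * π) := by
        rw [intervalIntegral.integral_const_mul]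
        gcongr
        exact integral_multiset_sum_map_le _ (fun z : ℂ => poissonKer z.re z.im)
          (fun z => continuous_poissonKer _ _) fun z => integral_poissonKer_le _ _ _ _
    _ ≤ 1 / ε * (P.natDegree * π) := by gcongr
    _ = _ := by ring

lemma norm_integral_exp_polynomial_le (Q : ℝ[X]) {ε a b : ℝ} (hε : 0 < ε) (hab : a ≤ b) :
    ‖∫ t in a..b, Complex.exp (2 * (π : ℂ) * Complex.I * (Q.eval t : ℝ))‖
      ≤ (∫ t in a..b, ε ^ 2 / (Q.derivative.eval t ^ 2 + ε ^ 2)) + 1 / ε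
        + ∫ t in a..b, |Q.derivative.derivative.eval t| / (Q.derivative.eval t ^ 2 + ε ^ 2) := by
  set P := Q.derivative with hP
  have hpos : ∀ t : ℝ, 0 < P.eval t ^ 2 + ε ^ 2 := fun t => by positivity
  have hne : ∀ t : ℝ, P.eval t ^ 2 + ε ^ 2 ≠ 0 := fun t => (hpos t).ne'
  set F : ℝ → ℂ := fun t => Complex.exp (2 * (π : ℂ) * Complex.I * (Q.eval t : ℝ)) with hF
  have hFn : ∀ t, ‖F t‖ = 1 := fun t => by
    have : 2 * (π : ℂ) * Complex.I * (Q.eval t : ℝ) = ((2 * π * Q.eval t : ℝ) : ℂ) * Complex.I := by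
      push_cast; ring
    simp only [hF]
    rw [this, Complex.norm_exp_ofReal_mul_I]
  have hFd : ∀ t, HasDerivAt F (F t * (2 * (π : ℂ) * Complex.I * (P.eval t : ℝ))) t := fun t => by
    have := ((Q.hasDerivAt t).ofReal_comp.const_mul (2 * (π : ℂ) * Complex.I)).cexp
    simpa [hF] using this
  have hFc : Continuous F := continuous_iff_continuousAt.mpr fun t => (hFd t).continuousAt
  set g : ℝ → ℝ := fun t => P.eval t / (P.eval t ^ 2 + ε ^ 2) with hg
  set g' : ℝ → ℝ := fun t =>
    P.derivative.eval t * (ε ^ 2 - P.eval t ^ 2) / (P.eval t ^ 2 + ε ^ 2) ^ 2 with hg'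
  have hgd : ∀ t, HasDerivAt g (g' t) t := fun t => by
    have := (P.hasDerivAt t).div (((P.hasDerivAt t).pow 2).add_const (ε ^ 2)) (hpos t).ne'
    refine this.congr_deriv ?_
    simp only [hg']
    congr 1
    simp
    ring
  have hgb : ∀ t, |g t| ≤ 1 / ε := fun t => by
    simp only [hg]
    rw [abs_div, abs_of_pos (hpos t), div_le_div_iff₀ (hpos t) hε, ← sq_abs (P.eval t)]
    nlinarith [sq_nonneg (|P.eval t| - ε), abs_nonneg (P.eval t)]
  have hg'b : ∀ t, |g' t| ≤ |P.derivative.eval t| / (P.eval t ^ 2 + ε ^ 2) := fun t => by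
    simp only [hg']
    rw [abs_div, abs_mul, abs_of_pos (pow_pos (hpos t) 2), div_le_div_iff₀ (pow_pos (hpos t) 2) (hpos t)]
    have : |ε ^ 2 - P.eval t ^ 2| ≤ P.eval t ^ 2 + ε ^ 2 :=
      abs_le.mpr ⟨by nlinarith, by nlinarith⟩
    calc _ ≤ |P.derivative.eval t| * (P.eval t ^ 2 + ε ^ 2) * (P.eval t ^ 2 + ε ^ 2) := by
          gcongr
      _ = _ := by ring
  have hg'c : Continuous g' := by
    have : ∀ t : ℝ, (P.eval t ^ 2 + ε ^ 2) ^ 2 ≠ 0 := fun t => (pow_pos (hpos t) 2).ne'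
    simp only [hg']
    fun_prop (disch := exact this _)
  have hgc : Continuous g := continuous_iff_continuousAt.mpr fun t => (hgd t).continuousAt
  set c : ℂ := 2 * (π : ℂ) * Complex.I with hc
  have hc0 : c ≠ 0 := by simp [hc, pi_ne_zero]
  have hcn : 2 ≤ ‖c‖ := by
    simp [hc, abs_of_pos pi_pos]
    linarith [pi_gt_three]
  have hsplit : ∀ t, F t = (F t * ((ε ^ 2 / (P.eval t ^ 2 + ε ^ 2) : ℝ) : ℂ) - F t * (g' t : ℂ) / c)
      + (F t * (c * (P.eval t : ℝ)) * (g t : ℂ) + F t * (g' t : ℂ)) / c := fun t => by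
    have h1 : ((ε ^ 2 / (P.eval t ^ 2 + ε ^ 2) : ℝ) : ℂ) = 1 - (P.eval t : ℝ) * (g t : ℂ) := by
      rw [← Complex.ofReal_mul, ← Complex.ofReal_one, ← Complex.ofReal_sub]
      congr 1
      simp only [hg]
      have := (hpos t).ne'
      field_simp
      ring
    rw [h1]
    field_simp
    ring
  have hWc : Continuous fun t : ℝ => ε ^ 2 / (P.eval t ^ 2 + ε ^ 2) := by
    fun_prop (disch := exact hne _)
  have hDc : Continuous fun t : ℝ => |P.derivative.eval t| / (P.eval t ^ 2 + ε ^ 2) := by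
    fun_prop (disch := exact hne _)
  have hHc : Continuous fun t : ℝ =>
      F t * ((ε ^ 2 / (P.eval t ^ 2 + ε ^ 2) : ℝ) : ℂ) - F t * (g' t : ℂ) / c := by
    have := Complex.continuous_ofReal.comp hWc
    have h2 := Complex.continuous_ofReal.comp hg'c
    exact (hFc.mul this).sub ((hFc.mul h2).div_const c)
  have hGc : Continuous fun t : ℝ =>
      F t * (c * (P.eval t : ℝ)) * (g t : ℂ) + F t * (g' t : ℂ) := by
    fun_prop
  have hG : ∫ t in a..b, (F t * (c * (P.eval t : ℝ)) * (g t : ℂ) + F t * (g' t : ℂ))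
      = F b * (g b : ℂ) - F a * (g a : ℂ) :=
    intervalIntegral.integral_eq_sub_of_hasDerivAt
      (fun t _ => (hFd t).mul (hgd t).ofReal_comp) (hGc.intervalIntegrable _ _)
  have hH : ‖∫ t in a..b,
      (F t * ((ε ^ 2 / (P.eval t ^ 2 + ε ^ 2) : ℝ) : ℂ) - F t * (g' t : ℂ) / c)‖
      ≤ ∫ t in a..b, (ε ^ 2 / (P.eval t ^ 2 + ε ^ 2)
        + |P.derivative.eval t| / (P.eval t ^ 2 + ε ^ 2)) := by
    refine intervalIntegral.norm_integral_le_of_norm_le hab (ae_of_all _ fun t _ => ?_)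
      ((hWc.add hDc).intervalIntegrable _ _)
    refine (norm_sub_le _ _).trans (add_le_add ?_ ?_)
    · rw [norm_mul, hFn, one_mul, Complex.norm_real, Real.norm_of_nonneg]
      have := hpos t
      positivity
    · rw [norm_div, norm_mul, hFn, one_mul, Complex.norm_real, Real.norm_eq_abs]
      refine (div_le_self (abs_nonneg _) (by linarith)).trans (hg'b t)
  have hbd : ‖(F b * (g b : ℂ) - F a * (g a : ℂ)) / c‖ ≤ 1 / ε := by
    rw [norm_div, div_le_iff₀ (by linarith)]
    have hn : ∀ t, ‖F t * (g t : ℂ)‖ ≤ 1 / ε := fun t => by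
      rw [norm_mul, hFn, one_mul, Complex.norm_real, Real.norm_eq_abs]
      exact hgb t
    have : 0 < 1 / ε := by positivity
    nlinarith [norm_sub_le (F b * (g b : ℂ)) (F a * (g a : ℂ)), hn a, hn b]
  rw [intervalIntegral.integral_congr (g := fun t =>
      (F t * ((ε ^ 2 / (P.eval t ^ 2 + ε ^ 2) : ℝ) : ℂ) - F t * (g' t : ℂ) / c)
      + (F t * (c * (P.eval t : ℝ)) * (g t : ℂ) + F t * (g' t : ℂ)) / c) fun t _ => hsplit t,
    intervalIntegral.integral_add (hHc.intervalIntegrable _ _)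
      ((hGc.div_const c).intervalIntegrable _ _), intervalIntegral.integral_div, hG]
  rw [intervalIntegral.integral_add (hWc.intervalIntegrable _ _)
      (hDc.intervalIntegrable _ _)] at hH
  refine (norm_add_le _ _).trans ?_
  linarith

lemma Multiset.exists_mem_pow_le_prod (s : Multiset ℝ) {n : ℕ} (hn : s.card ≤ n) {a : ℝ}
    (ha : a ∈ Set.Icc (0 : ℝ) 1) (hs : ∀ y ∈ s, y ∈ Set.Icc (0 : ℝ) 1) :
    ∃ y ∈ a ::ₘ s, y ^ n ≤ s.prod := by
  induction s using Multiset.induction generalizing n with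
  | empty => exact ⟨a, by simp, by simpa using pow_le_one₀ ha.1 ha.2⟩
  | cons b s ih =>
    obtain ⟨m, rfl⟩ : ∃ m, n = m + 1 := ⟨n - 1, by simp at hn; omega⟩
    obtain ⟨y, hy, hym⟩ := ih (n := m) (by simpa using hn)
      fun y hy => hs y (Multiset.mem_cons_of_mem hy)
    have hb := hs b (Multiset.mem_cons_self b s)
    have hy0 : 0 ≤ y := by
      rcases Multiset.mem_cons.mp hy with rfl | h
      · exact ha.1
      · exact (hs y (Multiset.mem_cons_of_mem h)).1
    rw [Multiset.prod_cons]
    rcases le_total y b with h | h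
    · refine ⟨y, ?_, ?_⟩
      · rcases Multiset.mem_cons.mp hy with rfl | h <;> simp [*]
      · rw [pow_succ']
        exact mul_le_mul h hym (by positivity) hb.1
    · refine ⟨b, by simp, ?_⟩
      rw [pow_succ']
      exact mul_le_mul_of_nonneg_left ((pow_le_pow_left₀ hb.1 h m).trans hym) hb.1

/-- Real part of `z` if `‖z‖ ≤ 2`, and `1` otherwise. -/
def nearRe (z : ℂ) : ℝ := if ‖z‖ ≤ 2 then z.re else 1

lemma abs_sub_nearRe_le_four {t : ℝ} (ht : t ∈ Set.Icc (1 / 2 : ℝ) 1) (z : ℂ) :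
    |t - nearRe z| ≤ 4 := by
  unfold nearRe
  rw [abs_le]
  split_ifs with h
  · have := abs_le.mp ((Complex.abs_re_le_norm z).trans h)
    constructor <;> linarith [ht.1, ht.2, this.1, this.2]
  · constructor <;> linarith [ht.1, ht.2]

lemma max_one_norm_mul_le_norm_sub {t : ℝ} (ht : t ∈ Set.Icc (1 / 2 : ℝ) 1) (z : ℂ) :
    max 1 ‖z‖ * (|t - nearRe z| / 4) ≤ ‖(t : ℂ) - z‖ := by
  unfold nearRe
  split_ifs with h
  · have h1 : |t - z.re| ≤ ‖(t : ℂ) - z‖ := by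
      simpa using Complex.abs_re_le_norm ((t : ℂ) - z)
    have h2 : max 1 ‖z‖ ≤ 2 := max_le (by norm_num) h
    have h3 : 0 ≤ max 1 ‖z‖ := by positivity
    nlinarith [abs_nonneg (t - z.re)]
  · push Not at h
    rw [max_eq_right (by linarith)]
    have h1 : ‖z‖ - 1 ≤ ‖(t : ℂ) - z‖ := by
      have := norm_sub_norm_le z (t : ℂ)
      rw [norm_sub_rev, Complex.norm_real, Real.norm_of_nonneg (by linarith [ht.1])] at this
      linarith [ht.2]
    have h2 : |t - 1| ≤ 1 / 2 := abs_le.mpr ⟨by linarith [ht.1], by linarith [ht.2]⟩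
    nlinarith [abs_nonneg (t - 1)]

lemma mul_prod_abs_sub_nearRe_le_abs_eval (P : ℝ[X]) {n i : ℕ} (hn : P.natDegree ≤ n) {t : ℝ}
    (ht : t ∈ Set.Icc (1 / 2 : ℝ) 1) :
    |P.coeff i| / 2 ^ n
      * ((P.map Complex.ofRealHom).roots.map fun z => |t - nearRe z| / 4).prod ≤ |P.eval t| := by
  set R := P.map Complex.ofRealHom with hR
  have hdeg : R.natDegree ≤ n := natDegree_map_le.trans hn
  have hev : ‖R.eval (t : ℂ)‖ = |P.eval t| := by
    have : eval ((Complex.ofRealHom t : ℂ)) (P.map Complex.ofRealHom)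
        = Complex.ofRealHom (P.eval t) := eval_map_apply _ _
    rw [← Real.norm_eq_abs, ← Complex.norm_real]
    exact congrArg norm this
  have hco : |P.coeff i| / 2 ^ n ≤ R.mahlerMeasure := by
    have h1 := R.norm_coeff_le_choose_mul_mahlerMeasure i
    rw [hR, coeff_map, ← hR] at h1
    have h2 : ‖Complex.ofRealHom (P.coeff i)‖ = |P.coeff i| := by simp
    rw [h2] at h1
    rw [div_le_iff₀ (by positivity), mul_comm]
    refine h1.trans ?_
    gcongr
    · exact R.mahlerMeasure_nonneg
    · have := (Nat.choose_le_two_pow R.natDegree i).trans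
        (Nat.pow_le_pow_right (by norm_num) hdeg)
      exact_mod_cast this
  have h0 : 0 ≤ (R.roots.map fun z => |t - nearRe z| / 4).prod := by
    refine Multiset.prod_nonneg fun y hy => ?_
    obtain ⟨z, _, rfl⟩ := Multiset.mem_map.mp hy
    positivity
  rw [← hev, (IsAlgClosed.splits R).eval_eq_prod_roots, norm_mul]
  refine (mul_le_mul_of_nonneg_right hco h0).trans ?_
  rw [mahlerMeasure_eq_leadingCoeff_mul_prod_roots, mul_assoc, ← Multiset.prod_map_mul]
  refine mul_le_mul_of_nonneg_left ?_ (norm_nonneg _)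
  have hn : ‖(R.roots.map fun z => (t : ℂ) - z).prod‖
      = (R.roots.map fun z => ‖(t : ℂ) - z‖).prod := by
    have := map_multiset_prod (normHom : ℂ →*₀ ℝ) (R.roots.map fun z => (t : ℂ) - z)
    simpa [Multiset.map_map, Function.comp_def] using this
  rw [hn]
  exact Multiset.prod_map_le_prod_map₀ _ _ (fun z _ => by positivity)
    fun z _ => max_one_norm_mul_le_norm_sub ht z

lemma sq_div_sq_add_sq_le {n : ℕ} (hn : n ≠ 0) {c ρ y p ε : ℝ} (hc : 0 < c) (hρ : 0 < ρ)
    (hy : 0 ≤ y) (hp : c * y ^ n ≤ |p|) (hε : ε = c * ρ ^ n) :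
    ε ^ 2 / (p ^ 2 + ε ^ 2) ≤ 2 * (ρ ^ 2 / (y ^ 2 + ρ ^ 2)) := by
  have hε0 : 0 < ε := hε ▸ by positivity
  rcases le_total y ρ with h | h
  · have h1 : ε ^ 2 / (p ^ 2 + ε ^ 2) ≤ 1 := by
      rw [div_le_one (by positivity)]
      nlinarith [sq_nonneg p]
    refine h1.trans ?_
    rw [← mul_div_assoc, le_div_iff₀ (by positivity)]
    nlinarith
  · have h1 : y * ε ≤ ρ * |p| := by
      obtain ⟨m, rfl⟩ := Nat.exists_eq_succ_of_ne_zero hn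
      have : ρ ^ m ≤ y ^ m := pow_le_pow_left₀ hρ.le h m
      calc y * ε = c * ρ * y * ρ ^ m := by rw [hε, pow_succ]; ring
        _ ≤ c * ρ * y * y ^ m := by gcongr
        _ = ρ * (c * y ^ (m + 1)) := by ring
        _ ≤ ρ * |p| := by gcongr
    have h2 : y ^ 2 * ε ^ 2 ≤ ρ ^ 2 * p ^ 2 := by
      rw [← sq_abs p, ← mul_pow, ← mul_pow]
      exact pow_le_pow_left₀ (by positivity) h1 2
    have h3 : ε ^ 2 / (p ^ 2 + ε ^ 2) ≤ ρ ^ 2 / (y ^ 2 + ρ ^ 2) := by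
      rw [div_le_div_iff₀ (by positivity) (by positivity)]
      nlinarith
    have : 0 ≤ ρ ^ 2 / (y ^ 2 + ρ ^ 2) := by positivity
    linarith

lemma integral_sq_div_sq_add_sq_le (P : ℝ[X]) {n i : ℕ} (hn : P.natDegree ≤ n) (hn0 : n ≠ 0)
    (hi : P.coeff i ≠ 0) {ρ ε : ℝ} (hρ : 0 < ρ) (hε : ε = |P.coeff i| / 2 ^ n * ρ ^ n) :
    ∫ t in (1 / 2 : ℝ)..1, ε ^ 2 / (P.eval t ^ 2 + ε ^ 2) ≤ 8 * (n + 1) * π * ρ := by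
  have hc : 0 < |P.coeff i| / 2 ^ n := by positivity
  have hε0 : 0 < ε := hε ▸ by positivity
  set X : Multiset ℝ := 1 ::ₘ (P.map Complex.ofRealHom).roots.map nearRe with hX
  have hcard : (X.card : ℝ) ≤ n + 1 := by
    have : X.card ≤ n + 1 := by
      simp only [hX, Multiset.card_cons, Multiset.card_map]
      exact Nat.succ_le_succ ((card_roots' _).trans (natDegree_map_le.trans hn))
    exact_mod_cast this
  have hpt : ∀ t ∈ Set.Icc (1 / 2 : ℝ) 1, ε ^ 2 / (P.eval t ^ 2 + ε ^ 2)
      ≤ 8 * ρ * (X.map fun x => poissonKer x (4 * ρ) t).sum := by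
    intro t ht
    obtain ⟨x, hx, hxp⟩ : ∃ x ∈ X, |P.coeff i| / 2 ^ n * (|t - x| / 4) ^ n ≤ |P.eval t| := by
      have hP := mul_prod_abs_sub_nearRe_le_abs_eval P (i := i) hn ht
      obtain ⟨y, hy, hyp⟩ := Multiset.exists_mem_pow_le_prod
        ((P.map Complex.ofRealHom).roots.map fun z => |t - nearRe z| / 4) (n := n)
        (a := |t - 1| / 4)
        (by simpa using (card_roots' _).trans (natDegree_map_le.trans hn))
        ⟨by positivity, by
          have : |t - 1| ≤ 4 := abs_le.mpr ⟨by linarith [ht.1], by linarith [ht.2]⟩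
          linarith⟩
        (fun y hy => by
          obtain ⟨z, _, rfl⟩ := Multiset.mem_map.mp hy
          exact ⟨by positivity, by linarith [abs_sub_nearRe_le_four ht z]⟩)
      have hle := (mul_le_mul_of_nonneg_left hyp hc.le).trans hP
      rcases Multiset.mem_cons.mp hy with rfl | hy
      · exact ⟨1, by simp [hX], hle⟩
      · obtain ⟨z, hz, rfl⟩ := Multiset.mem_map.mp hy
        exact ⟨nearRe z, Multiset.mem_cons_of_mem (Multiset.mem_map_of_mem _ hz), hle⟩
    have h1 := sq_div_sq_add_sq_le hn0 hc hρ (by positivity) hxp hε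
    have h2 : 2 * (ρ ^ 2 / ((|t - x| / 4) ^ 2 + ρ ^ 2)) = 8 * ρ * poissonKer x (4 * ρ) t := by
      rw [div_pow, sq_abs, poissonKer, abs_of_pos (by positivity)]
      have : (t - x) ^ 2 + (4 * ρ) ^ 2 ≠ 0 := by positivity
      have : (t - x) ^ 2 / 4 ^ 2 + ρ ^ 2 ≠ 0 := by positivity
      field_simp
      ring
    rw [h2] at h1
    refine h1.trans ?_
    gcongr
    exact Multiset.single_le_sum (fun y hy => by
      obtain ⟨z, _, rfl⟩ := Multiset.mem_map.mp hy
      exact poissonKer_nonneg _ _ _) _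
      (Multiset.mem_map_of_mem (fun x => poissonKer x (4 * ρ) t) hx)
  have hne : ∀ t : ℝ, P.eval t ^ 2 + ε ^ 2 ≠ 0 := fun t => by positivity
  calc _ ≤ ∫ t in (1 / 2 : ℝ)..1, 8 * ρ * (X.map fun x => poissonKer x (4 * ρ) t).sum := by
        refine intervalIntegral.integral_mono_on (by norm_num) ?_ ?_ hpt
        · refine Continuous.intervalIntegrable ?_ _ _
          fun_prop (disch := exact hne _)
        · exact ((continuous_multiset_sum_map _ (fun x => poissonKer x (4 * ρ)) fun x =>
            continuous_poissonKer _ _).const_mul _).intervalIntegrable _ _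
    _ ≤ 8 * ρ * (X.card * π) := by
        rw [intervalIntegral.integral_const_mul]
        gcongr
        exact integral_multiset_sum_map_le _ (fun x => poissonKer x (4 * ρ))
          (fun x => continuous_poissonKer _ _) fun x => integral_poissonKer_le _ _ _ _
    _ ≤ 8 * ρ * ((n + 1) * π) := by gcongr
    _ = _ := by ring

lemma norm_integral_exp_polynomial_le_of_coeff (Q : ℝ[X]) {d j : ℕ} (hd : 2 ≤ d)
    (hQ : Q.natDegree ≤ d) (hj : 1 ≤ j) (hQj : Q.coeff j ≠ 0) :
    ‖∫ t in (1 / 2 : ℝ)..1, Complex.exp (2 * (π : ℂ) * Complex.I * (Q.eval t : ℝ))‖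
      ≤ (8 * d * π + 2 ^ d * (1 + d * π)) * |Q.coeff j| ^ (-(1 : ℝ) / d) := by
  obtain ⟨n, rfl⟩ : ∃ n, d = n + 1 := ⟨d - 1, by omega⟩
  obtain ⟨i, rfl⟩ : ∃ i, j = i + 1 := ⟨j - 1, by omega⟩
  set P := Q.derivative with hP
  set M := |Q.coeff (i + 1)| with hM
  have hM0 : 0 < M := abs_pos.mpr hQj
  set ρ := M ^ (-(1 : ℝ) / (n + 1 : ℕ)) with hρ
  have hρ0 : 0 < ρ := rpow_pos_of_pos hM0 _
  have hρM : M * ρ ^ (n + 1) = 1 := by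
    rw [hρ, ← rpow_natCast, ← rpow_mul hM0.le, div_mul_cancel₀ _ (by positivity),
      rpow_neg_one, mul_inv_cancel₀ hM0.ne']
  have hPdeg : P.natDegree ≤ n := (natDegree_derivative_le Q).trans (by omega)
  have hPi : P.coeff i = Q.coeff (i + 1) * (i + 1) := coeff_derivative Q i
  have hPi0 : P.coeff i ≠ 0 := by
    rw [hPi]; exact mul_ne_zero hQj (by positivity)
  have hPM : M ≤ |P.coeff i| := by
    rw [hPi, abs_mul, abs_of_nonneg (show (0 : ℝ) ≤ i + 1 by positivity)]
    exact le_mul_of_one_le_right hM0.le (by linarith [show (0 : ℝ) ≤ i by positivity])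
  set ε := |P.coeff i| / 2 ^ n * ρ ^ n with hε
  have hε0 : 0 < ε := by positivity
  have hεinv : 1 / ε ≤ 2 ^ (n + 1) * ρ := by
    rw [div_le_iff₀ hε0, hε]
    calc (1 : ℝ) = M * ρ ^ (n + 1) := hρM.symm
      _ ≤ |P.coeff i| * ρ ^ (n + 1) := by gcongr
      _ ≤ 2 * (|P.coeff i| * ρ ^ (n + 1)) := by
        linarith [show 0 ≤ |P.coeff i| * ρ ^ (n + 1) by positivity]
      _ = _ := by field_simp; ring
  have h1 := norm_integral_exp_polynomial_le Q hε0 (show (1 / 2 : ℝ) ≤ 1 by norm_num)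
  have h2 := integral_sq_div_sq_add_sq_le P hPdeg (by omega) hPi0 hρ0 hε
  have h3 := integral_abs_derivative_div_le P hε0 (show (1 / 2 : ℝ) ≤ 1 by norm_num)
  have h4 : P.natDegree * π / ε ≤ (n + 1) * π * (2 ^ (n + 1) * ρ) := by
    rw [div_eq_mul_one_div]
    have : (P.natDegree : ℝ) ≤ n + 1 := by exact_mod_cast hPdeg.trans (Nat.le_succ n)
    gcongr
  refine h1.trans ?_
  push_cast
  linarith

lemma norm_integral_exp_linear_le {a b h : ℝ} (hh : h ≠ 0) :
    ‖∫ t in a..b, Complex.exp (2 * (π : ℂ) * Complex.I * ((h * t : ℝ) : ℂ))‖ ≤ |h|⁻¹ := by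
  have hc : 2 * (π : ℂ) * Complex.I * h ≠ 0 := by simp [pi_ne_zero, hh]
  have he : ∀ t : ℝ, ‖Complex.exp (2 * (π : ℂ) * Complex.I * h * t)‖ = 1 := fun t => by
    have : 2 * (π : ℂ) * Complex.I * h * t = ((2 * π * h * t : ℝ) : ℂ) * Complex.I := by
      push_cast; ring
    rw [this, Complex.norm_exp_ofReal_mul_I]
  have heq : ∀ t : ℝ, Complex.exp (2 * (π : ℂ) * Complex.I * ((h * t : ℝ) : ℂ))
      = Complex.exp (2 * (π : ℂ) * Complex.I * h * t) := fun t => by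
    push_cast; ring_nf
  simp_rw [heq]
  rw [integral_exp_mul_complex hc, norm_div]
  have hn : ‖2 * (π : ℂ) * Complex.I * h‖ = 2 * π * |h| := by
    simp [abs_of_pos pi_pos]
  have hh0 : 0 < |h| := abs_pos.mpr hh
  rw [hn, div_le_iff₀ (by positivity)]
  have h1 := norm_sub_le (Complex.exp (2 * (π : ℂ) * Complex.I * h * b))
    (Complex.exp (2 * (π : ℂ) * Complex.I * h * a))
  rw [he, he] at h1
  have h2 : |h|⁻¹ * (2 * π * |h|) = 2 * π := by field_simp
  rw [h2]
  linarith [pi_gt_three]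

/-- For every `d` there is `C_d` such that for every real polynomial
`Q(s) = Σ_{j=1}^d h_j s^j`, every `1 ≤ j ≤ d` with `h_j ≠ 0`, and every `B > 0`,
`|∫_{B/2}^B e^{2πi Q(s)} ds| ≤ C_d |h_j|^{-1/d} B^{1 - j/d}`. -/
theorem oscillatory_dyadic_single_coefficient (d : ℕ) :
    ∃ C : ℝ, ∀ h : ℕ → ℝ, ∀ j : ℕ, 1 ≤ j → j ≤ d → h j ≠ 0 → ∀ B : ℝ, 0 < B →
      ‖∫ s in (B / 2)..B,
          Complex.exp (2 * (π : ℂ) * Complex.I *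
            ((∑ i ∈ Finset.Icc 1 d, h i * s ^ i : ℝ) : ℂ))‖
        ≤ C * |h j| ^ (-(1 : ℝ) / d) * B ^ (1 - (j : ℝ) / d) := by
  rcases Nat.lt_or_ge d 2 with hd | hd
  · refine ⟨1, fun h j hj hjd hh B hB => ?_⟩
    obtain rfl : j = 1 := by omega
    obtain rfl : d = 1 := by omega
    simpa [rpow_neg_one] using norm_integral_exp_linear_le (a := B / 2) (b := B) hh
  · refine ⟨8 * d * π + 2 ^ d * (1 + d * π), fun h j hj hjd hh B hB => ?_⟩
    set Q : ℝ[X] := ∑ i ∈ Finset.Icc 1 d, monomial i (h i * B ^ i) with hQ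
    have hdeg : Q.natDegree ≤ d := natDegree_sum_le_of_forall_le _ _ fun i hi =>
      (natDegree_monomial_le _).trans (Finset.mem_Icc.mp hi).2
    have hcoeff : Q.coeff j = h j * B ^ j := by
      simp [hQ, coeff_monomial, hj, hjd]
    have heval : ∀ t : ℝ, Q.eval t = ∑ i ∈ Finset.Icc 1 d, h i * (B * t) ^ i := fun t => by
      simp [hQ, eval_finsetSum, mul_pow, mul_assoc]
    have key := norm_integral_exp_polynomial_le_of_coeff Q hd hdeg hj
      (by rw [hcoeff]; positivity)
    have hscale := intervalIntegral.smul_integral_comp_mul_left (a := 1 / 2) (b := 1)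
      (fun s : ℝ => Complex.exp (2 * (π : ℂ) * Complex.I *
            ((∑ i ∈ Finset.Icc 1 d, h i * s ^ i : ℝ) : ℂ))) B
    rw [mul_one_div, mul_one] at hscale
    rw [← hscale, norm_smul, Real.norm_of_nonneg hB.le]
    simp_rw [heval] at key
    refine (mul_le_mul_of_nonneg_left key hB.le).trans (le_of_eq ?_)
    rw [hcoeff, abs_mul, abs_of_pos (pow_pos hB j), mul_rpow (abs_nonneg _) (by positivity),
      ← rpow_natCast B, ← rpow_mul hB.le, sub_eq_add_neg, rpow_add hB, rpow_one]
    have : (j : ℝ) * (-1 / d) = -(j / d) := by ring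
    rw [this]
    ring
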